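/- Let τ be a Hopf algebra automorphism of H with τ^m = Id and suppose τ(Λ) = Λ. Then Σ_(Λ) Λ₁ ⊗ τ(Λ₂) ⊗ ⋯ ⊗ τ^{m-1}(Λ_m) = Σ_(Λ) τ(Λ₂) ⊗ ⋯ ⊗ τ^{m-1}(Λ_m) ⊗ Λ₁; that is, the twisted iterated comultiplication of the integral is invariant under the cyclic shift sending the first tensor factor to the end. -/

import Mathlib

open TensorProduct

noncomputable section

universe u

variable (k : Type u) [Field k]

/-- `twistedMulMap τ n : h ↦ Σ h₁ · τ(h₂) · ⋯ · τⁿ(h_{n+1})`, the product of the `n+1`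
Sweedler factors of the iterated comultiplication with the twist `τ` applied progressively. -/
def twistedMulMap (H : Type u) [Ring H] [HopfAlgebra k H] (τ : H →ₗ[k] H) :
    ℕ → (H →ₗ[k] H)
  | 0 => LinearMap.id
  | n + 1 => LinearMap.mul' k H ∘ₗ TensorProduct.map LinearMap.id (τ ∘ₗ twistedMulMap H τ n)
      ∘ₗ Coalgebra.comul (R := k)

/-- `powLM τ n` is the `n`-fold composition `τ ∘ ⋯ ∘ τ`. -/
def powLM (H : Type u) [Ring H] [HopfAlgebra k H] (τ : H →ₗ[k] H) : ℕ → (H →ₗ[k] H)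
  | 0 => LinearMap.id
  | n + 1 => τ ∘ₗ powLM H τ n

/-- Bundled `n`-fold tensor power `V ⊗ (V ⊗ (⋯ ⊗ k))`. -/
def TPc (V : Type u) [AddCommGroup V] [Module k V] : ℕ → ModuleCat.{u} k
  | 0 => ModuleCat.of k k
  | n + 1 => ModuleCat.of k (V ⊗[k] (TPc V n : Type u))

/-- The `n`-fold tensor power `V^{⊗n}` of `V` (with a trailing scalar factor). -/
abbrev TP (V : Type u) [AddCommGroup V] [Module k V] (n : ℕ) : Type u := (TPc k V n : Type u)

variable (H : Type u) [Ring H] [HopfAlgebra k H]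
variable (V : Type u) [AddCommGroup V] [Module k V]

/-- Append a vector at the end of a tensor power. -/
def TP.snoc : ∀ n, (TP k V n ⊗[k] V) →ₗ[k] TP k V (n + 1)
  | 0 => (TensorProduct.comm k k V).toLinearMap
  | n + 1 => (TensorProduct.map LinearMap.id (TP.snoc n)) ∘ₗ
      (TensorProduct.assoc k V (TP k V n) V).toLinearMap

/-- The cyclic shift `α : v₁ ⊗ v₂ ⊗ ⋯ ⊗ vₙ ↦ v₂ ⊗ ⋯ ⊗ vₙ ⊗ v₁`. -/
def TP.cyc : ∀ n, TP k V n →ₗ[k] TP k V n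
  | 0 => LinearMap.id
  | n + 1 => TP.snoc k V n ∘ₗ (TensorProduct.comm k V (TP k V n)).toLinearMap

/-- Apply `τ` to every tensor factor of `H^{⊗n}`. -/
def TP.mapAll (τ : H →ₗ[k] H) : ∀ n, TP k H n →ₗ[k] TP k H n
  | 0 => LinearMap.id
  | n + 1 => TensorProduct.map τ (TP.mapAll τ n)

/-- Twisted iterated comultiplication `h ↦ Σ h₁ ⊗ τ(h₂) ⊗ ⋯ ⊗ τ^{n-1}(hₙ)`. -/
def TP.dtw (τ : H →ₗ[k] H) : ∀ n, H →ₗ[k] TP k H n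
  | 0 => Coalgebra.counit (R := k)
  | n + 1 => TensorProduct.map LinearMap.id (TP.mapAll k H τ n ∘ₗ TP.dtw τ n) ∘ₗ
      Coalgebra.comul (R := k)

theorem powLM_apply_comm (τ : H →ₗ[k] H) (n : ℕ) (h : H) :
    powLM k H τ n (τ h) = τ (powLM k H τ n h) := by
  induction n with
  | zero => rfl
  | succ n ih => exact congrArg τ ih

theorem TP.mapAll_comp_snoc (τ : H →ₗ[k] H) (n : ℕ) :
    TP.mapAll k H τ (n + 1) ∘ₗ TP.snoc k H n =
      TP.snoc k H n ∘ₗ TensorProduct.map (TP.mapAll k H τ n) τ := by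
  induction n with
  | zero => exact TensorProduct.ext' fun x v => rfl
  | succ n ih =>
    refine TensorProduct.ext_threefold (R := k) (M := H) (N := TP k H n) (P := H) fun v x w => ?_
    exact congrArg (fun y : TP k H (n + 1) => (τ v ⊗ₜ[k] y : H ⊗[k] TP k H (n + 1)))
      (LinearMap.congr_fun ih (x ⊗ₜ[k] w))

/-- A coalgebra endomorphism commutes with the twisted iterated comultiplication. -/
theorem TP.mapAll_comp_dtw (τ : H →ₗ[k] H)
    (hcomul : Coalgebra.comul (R := k) ∘ₗ τ =
      TensorProduct.map τ τ ∘ₗ Coalgebra.comul (R := k))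
    (hcounit : Coalgebra.counit (R := k) ∘ₗ τ = Coalgebra.counit (R := k)) (n : ℕ) :
    TP.mapAll k H τ n ∘ₗ TP.dtw k H τ n = TP.dtw k H τ n ∘ₗ τ := by
  induction n with
  | zero => exact hcounit.symm
  | succ n ih =>
    change TensorProduct.map τ (TP.mapAll k H τ n) ∘ₗ
        (TensorProduct.map LinearMap.id (TP.mapAll k H τ n ∘ₗ TP.dtw k H τ n) ∘ₗ
          Coalgebra.comul (R := k)) =
      (TensorProduct.map LinearMap.id (TP.mapAll k H τ n ∘ₗ TP.dtw k H τ n) ∘ₗ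
          Coalgebra.comul (R := k)) ∘ₗ τ
    rw [LinearMap.comp_assoc, hcomul, ← LinearMap.comp_assoc, ← LinearMap.comp_assoc,
      ← TensorProduct.map_comp, ← TensorProduct.map_comp, LinearMap.comp_id, LinearMap.id_comp,
      LinearMap.comp_assoc τ, ← ih]

/-- The twisted iterated comultiplication may be expanded at the last tensor factor. -/
theorem TP.dtw_succ_eq_snoc (τ : H →ₗ[k] H) (n : ℕ) :
    TP.dtw k H τ (n + 1) =
      TP.snoc k H n ∘ₗ TensorProduct.map (TP.dtw k H τ n) (powLM k H τ n) ∘ₗ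
        Coalgebra.comul (R := k) := by
  induction n with
  | zero =>
    ext h
    change LinearMap.lTensor H (Coalgebra.counit (R := k)) (Coalgebra.comul (R := k) h) =
      TensorProduct.comm k k H
        (LinearMap.rTensor H (Coalgebra.counit (R := k)) (Coalgebra.comul (R := k) h))
    rw [Coalgebra.lTensor_counit_comul, Coalgebra.rTensor_counit_comul, TensorProduct.comm_tmul]
  | succ n ih =>
    set A : H →ₗ[k] TP k H n := TP.mapAll k H τ n ∘ₗ TP.dtw k H τ n
    set B : H →ₗ[k] H := powLM k H τ (n + 1)
    have key : TP.mapAll k H τ (n + 1) ∘ₗ TP.dtw k H τ (n + 1) =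
        TP.snoc k H n ∘ₗ TensorProduct.map A B ∘ₗ Coalgebra.comul (R := k) := by
      rw [ih, ← LinearMap.comp_assoc, TP.mapAll_comp_snoc, LinearMap.comp_assoc,
        ← LinearMap.comp_assoc (Coalgebra.comul (R := k)), ← TensorProduct.map_comp]
      rfl
    have expand : TensorProduct.map LinearMap.id
          (TP.snoc k H n ∘ₗ TensorProduct.map A B) ∘ₗ
          (TensorProduct.assoc k H H H).toLinearMap =
        TP.snoc k H (n + 1) ∘ₗ
          TensorProduct.map (TensorProduct.map (LinearMap.id : H →ₗ[k] H) A) B :=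
      TensorProduct.ext_threefold fun x y z => rfl
    ext h
    change TensorProduct.map LinearMap.id
          (TP.mapAll k H τ (n + 1) ∘ₗ TP.dtw k H τ (n + 1)) (Coalgebra.comul (R := k) h) =
      TP.snoc k H (n + 1) (TensorProduct.map
        (TensorProduct.map (LinearMap.id : H →ₗ[k] H) A ∘ₗ Coalgebra.comul (R := k)) B
          (Coalgebra.comul (R := k) h))
    have hl : TensorProduct.map (LinearMap.id : H →ₗ[k] H)
          ((TP.snoc k H n ∘ₗ TensorProduct.map A B) ∘ₗ Coalgebra.comul (R := k)) =
        TensorProduct.map LinearMap.id (TP.snoc k H n ∘ₗ TensorProduct.map A B) ∘ₗ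
          LinearMap.lTensor H (Coalgebra.comul (R := k)) :=
      TensorProduct.ext' fun x y => rfl
    have hr : TensorProduct.map
          (TensorProduct.map (LinearMap.id : H →ₗ[k] H) A ∘ₗ Coalgebra.comul (R := k)) B =
        TensorProduct.map (TensorProduct.map (LinearMap.id : H →ₗ[k] H) A) B ∘ₗ
          LinearMap.rTensor H (Coalgebra.comul (R := k)) :=
      TensorProduct.ext' fun x y => rfl
    rw [key, ← LinearMap.comp_assoc, hl, hr, LinearMap.comp_apply, LinearMap.comp_apply,
      ← Coalgebra.coassoc_apply]
    exact LinearMap.congr_fun expand _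

/-- **Theorem.** Let `H` be a finite-dimensional Hopf algebra over an algebraically closed field
of characteristic `0` whose normalized two-sided integral `Λ` is cocommutative, and let `τ` be a
Hopf algebra automorphism with `τ^m = Id` fixing `Λ`.  Then the twisted iterated
comultiplication `Σ Λ₁ ⊗ τ(Λ₂) ⊗ ⋯ ⊗ τ^{m-1}(Λ_m)` of the integral is invariant under the
cyclic shift sending the first tensor factor to the end. -/
theorem twisted_comul_of_integral_is_cyclic_invariant
    [IsAlgClosed k] [CharZero k] [FiniteDimensional k H]
    (Λ : H)
    (hΛleft : ∀ a : H, a * Λ = Coalgebra.counit (R := k) a • Λ)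
    (hΛright : ∀ a : H, Λ * a = Coalgebra.counit (R := k) a • Λ)
    (hΛone : Coalgebra.counit (R := k) Λ = 1)
    (hΛcc : TensorProduct.comm k H H (Coalgebra.comul (R := k) Λ) = Coalgebra.comul (R := k) Λ)
    (m : ℕ) (hm : 0 < m)
    (τ : H →ₗ[k] H)
    (hτmul : ∀ a b : H, τ (a * b) = τ a * τ b) (hτone : τ 1 = 1)
    (hτcomul : Coalgebra.comul (R := k) ∘ₗ τ =
      TensorProduct.map τ τ ∘ₗ Coalgebra.comul (R := k))
    (hτcounit : Coalgebra.counit (R := k) ∘ₗ τ = Coalgebra.counit (R := k))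
    (hτord : powLM k H τ m = LinearMap.id)
    (hτΛ : τ Λ = Λ) :
    TP.cyc k H m (TP.dtw k H τ m Λ) = TP.dtw k H τ m Λ := by
  obtain ⟨n, rfl⟩ : ∃ n, m = n + 1 := ⟨m - 1, by omega⟩
  have hcomulΛ : Coalgebra.comul (R := k) Λ =
      TensorProduct.map τ τ (Coalgebra.comul (R := k) Λ) := by
    simpa [hτΛ] using LinearMap.congr_fun hτcomul Λ
  have hpow : powLM k H τ n ∘ₗ τ = LinearMap.id := by
    rw [← hτord]
    exact LinearMap.ext (powLM_apply_comm k H τ n)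
  have hswap : (TensorProduct.comm k H (TP k H n)).toLinearMap ∘ₗ
        TensorProduct.map LinearMap.id (TP.dtw k H τ n ∘ₗ τ) =
      TensorProduct.map (TP.dtw k H τ n ∘ₗ τ) LinearMap.id ∘ₗ
        (TensorProduct.comm k H H).toLinearMap :=
    TensorProduct.ext' fun x y => rfl
  have hleft : TP.cyc k H (n + 1) (TP.dtw k H τ (n + 1) Λ) =
      TP.snoc k H n (TensorProduct.map (TP.dtw k H τ n ∘ₗ τ) LinearMap.id
        (Coalgebra.comul (R := k) Λ)) := by
    change TP.snoc k H n (TensorProduct.comm k H (TP k H n)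
      (TensorProduct.map LinearMap.id (TP.mapAll k H τ n ∘ₗ TP.dtw k H τ n)
        (Coalgebra.comul (R := k) Λ))) = _
    rw [TP.mapAll_comp_dtw k H τ hτcomul hτcounit]
    refine congrArg (TP.snoc k H n) ((LinearMap.congr_fun hswap _).trans ?_)
    exact congrArg _ hΛcc
  rw [hleft, TP.dtw_succ_eq_snoc, LinearMap.comp_apply, LinearMap.comp_apply]
  conv_rhs => rw [hcomulΛ]
  rw [← LinearMap.comp_apply (TensorProduct.map (TP.dtw k H τ n) (powLM k H τ n)),
    ← TensorProduct.map_comp, hpow]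

end
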